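/- arXiv:2309.02108 — 7 statements merged into one kernel-verified Lean document; each statement's English description precedes it below -/
import Mathlib

section
/- For all real numbers f, p one has 2(f²+p²+fp+f+p+1) = (f+p+1)² + (f²+p²+1) > 0, and if (f,p) ≠ (1,1) then −1 ≤ −(f²+p²+1)/(2(f²+p²+fp+f+p+1)) < −1/4; moreover this quantity equals −1 if and only if f+p+1 = 0. -/
theorem critical_parameter_diagonal_derivation (f p : ℝ) :
    2 * (f^2 + p^2 + f*p + f + p + 1) = (f + p + 1)^2 + (f^2 + p^2 + 1) ∧
    0 < 2 * (f^2 + p^2 + f*p + f + p + 1) ∧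
    ((f, p) ≠ (1, 1) →
      -1 ≤ -(f^2 + p^2 + 1) / (2 * (f^2 + p^2 + f*p + f + p + 1)) ∧
      -(f^2 + p^2 + 1) / (2 * (f^2 + p^2 + f*p + f + p + 1)) < -(1/4)) ∧
    (-(f^2 + p^2 + 1) / (2 * (f^2 + p^2 + f*p + f + p + 1)) = -1 ↔ f + p + 1 = 0) := by
  have hD : 2 * (f^2 + p^2 + f*p + f + p + 1) = (f + p + 1)^2 + (f^2 + p^2 + 1) := by ring
  have hpos : 0 < (f + p + 1)^2 + (f^2 + p^2 + 1) := by positivity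
  rw [hD]
  refine ⟨rfl, hpos, fun hne => ⟨?_, ?_⟩, ?_⟩
  · rw [le_div_iff₀ hpos]
    linarith [sq_nonneg (f + p + 1)]
  · have hsq : 0 < (f - 1)^2 + (p - 1)^2 := by
      by_contra! h
      have hf : f - 1 = 0 := by
        rw [← sq_eq_zero_iff]
        linarith [sq_nonneg (f - 1), sq_nonneg (p - 1)]
      have hp : p - 1 = 0 := by
        rw [← sq_eq_zero_iff]
        linarith [sq_nonneg (f - 1), sq_nonneg (p - 1)]
      exact hne (Prod.ext (sub_eq_zero.mp hf) (sub_eq_zero.mp hp))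
    rw [div_lt_iff₀ hpos]
    linarith [sq_nonneg (f - p)]
  · rw [div_eq_iff hpos.ne', ← sq_eq_zero_iff (a := f + p + 1)]
    constructor <;> intro h <;> linarith
end

section
/- Fix a real number λ ∈ (−1,0) ∪ (0,1) and consider the equation 4b⁴ − (3λ²−2λ+3)b² − (λ−1)²λ = 0 in the real unknown b. If λ ∈ (0,1) this equation has exactly one solution with b > 0, while if λ ∈ (−1,0) it has exactly two solutions with b > 0. -/
/-- The quartic defining the structure constant factors over its two roots in `b ^ 2`. -/
lemma exists_factorization_quartic {l : ℝ} (hl : -1 < l) :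
    ∃ x y : ℝ, x < y ∧ 0 < x + y ∧ 4 * (x * y) = -((l - 1) ^ 2 * l) ∧
      ∀ b : ℝ, 4*b^4 - (3*l^2 - 2*l + 3)*b^2 - (l - 1)^2 * l = 4 * ((b^2 - x) * (b^2 - y)) := by
  have hD : 0 < (l + 1) ^ 2 * (9 * l ^ 2 - 14 * l + 9) :=
    mul_pos (pow_pos (by linarith) 2) (by nlinarith [sq_nonneg (9 * l - 7)])
  obtain ⟨s, hs, hsq⟩ : ∃ s : ℝ, 0 < s ∧ s ^ 2 = (l + 1) ^ 2 * (9 * l ^ 2 - 14 * l + 9) :=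
    ⟨_, Real.sqrt_pos.2 hD, Real.sq_sqrt hD.le⟩
  refine ⟨(3*l^2 - 2*l + 3 - s) / 8, (3*l^2 - 2*l + 3 + s) / 8, by linarith,
    by nlinarith [sq_nonneg (3 * l - 1)], by linear_combination -hsq / 16, fun b => ?_⟩
  linear_combination hsq / 16

theorem family2_positive_solutions (l : ℝ) :
    (l ∈ Set.Ioo (0:ℝ) 1 →
      ∃! b : ℝ, 0 < b ∧ 4*b^4 - (3*l^2 - 2*l + 3)*b^2 - (l - 1)^2 * l = 0) ∧
    (l ∈ Set.Ioo (-1:ℝ) 0 →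
      {b : ℝ | 0 < b ∧ 4*b^4 - (3*l^2 - 2*l + 3)*b^2 - (l - 1)^2 * l = 0}.encard = 2) := by
  refine ⟨fun ⟨h0, h1⟩ => ?_, fun ⟨h0, h1⟩ => ?_⟩
  · obtain ⟨x, y, hxy, hsum, hprod, hfac⟩ := exists_factorization_quartic (l := l) (by linarith)
    have hq : 0 < (l - 1) ^ 2 * l := mul_pos (sq_pos_of_neg (by linarith)) h0
    have hy : 0 < y := by linarith
    have hx : x < 0 := by
      by_contra! h
      linarith [mul_nonneg h hy.le]
    refine ⟨√y, ⟨Real.sqrt_pos.2 hy, by rw [hfac, Real.sq_sqrt hy.le]; ring⟩, ?_⟩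
    rintro b ⟨hb, hb'⟩
    rw [hfac] at hb'
    have hbx : b ^ 2 - x ≠ 0 := by nlinarith [sq_nonneg b]
    have hby : b ^ 2 = y := by simpa [hbx, sub_eq_zero] using hb'
    rw [← hby, Real.sqrt_sq hb.le]
  · obtain ⟨x, y, hxy, hsum, hprod, hfac⟩ := exists_factorization_quartic h0
    have hq : (l - 1) ^ 2 * l < 0 :=
      mul_neg_of_pos_of_neg (sq_pos_of_neg (by linarith)) h1
    have hy : 0 < y := by linarith
    have hx : 0 < x := by
      by_contra! h
      linarith [mul_nonpos_of_nonpos_of_nonneg h hy.le]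
    have hset : {b : ℝ | 0 < b ∧ 4*b^4 - (3*l^2 - 2*l + 3)*b^2 - (l - 1)^2 * l = 0} =
        {√x, √y} := by
      ext b
      simp only [Set.mem_ofPred_eq, Set.mem_insert_iff, Set.mem_singleton_iff, hfac]
      constructor
      · rintro ⟨hb, hb'⟩
        have hbxy : b ^ 2 = x ∨ b ^ 2 = y := by simpa [sub_eq_zero] using hb'
        exact hbxy.imp (fun h => by rw [← h, Real.sqrt_sq hb.le])
          (fun h => by rw [← h, Real.sqrt_sq hb.le])
      · rintro (rfl | rfl)
        · exact ⟨Real.sqrt_pos.2 hx, by rw [Real.sq_sqrt hx.le]; ring⟩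
        · exact ⟨Real.sqrt_pos.2 hy, by rw [Real.sq_sqrt hy.le]; ring⟩
    rw [hset]
    exact Set.encard_pair (Real.sqrt_lt_sqrt hx.le hxy).ne
end

section
/- Define φ : [−√3/2, 1/2) → ℝ by φ(a) = −3/(2(4ad+5)), where d = (−a + √(3−3a²))/2. Then φ is a strictly increasing bijection from [−√3/2, 1/2) onto [−3/4, −1/4). -/
/-- Writing `a = sin θ` linearises the parameter function. -/
lemma neg_three_div_eq_of_sin {θ : ℝ} (h₁ : -(Real.pi / 2) ≤ θ) (h₂ : θ ≤ Real.pi / 2) :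
    -3 / (2 * (4 * Real.sin θ *
      ((-Real.sin θ + Real.sqrt (3 - 3 * Real.sin θ ^ 2)) / 2) + 5)) =
      -3 / (4 * (Real.sin (2 * θ + Real.pi / 6) + 2)) := by
  have hcos : 0 ≤ Real.cos θ := Real.cos_nonneg_of_mem_Icc ⟨h₁, h₂⟩
  have hsqrt : Real.sqrt (3 - 3 * Real.sin θ ^ 2) = Real.sqrt 3 * Real.cos θ := by
    rw [← Real.sqrt_sq hcos, ← Real.sqrt_mul (by norm_num), Real.cos_sq']
    congr 1
    ring
  rw [hsqrt, Real.sin_add, Real.sin_two_mul, Real.cos_two_mul, Real.cos_sq', Real.sin_pi_div_six,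
    Real.cos_pi_div_six]
  congr 1
  ring

lemma sin_neg_pi_div_three : Real.sin (-(Real.pi / 3)) = -(Real.sqrt 3) / 2 := by
  rw [Real.sin_neg, Real.sin_pi_div_three, neg_div]

lemma arcsin_mem_Ico {a : ℝ} (ha : a ∈ Set.Ico (-(Real.sqrt 3) / 2) (1 / 2 : ℝ)) :
    Real.arcsin a ∈ Set.Ico (-(Real.pi / 3)) (Real.pi / 6) := by
  have hpi := Real.pi_pos
  constructor
  · rw [Real.le_arcsin_iff_sin_le' ⟨by linarith, by linarith⟩, sin_neg_pi_div_three]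
    exact ha.1
  · rw [Real.arcsin_lt_iff_lt_sin' ⟨by linarith, by linarith⟩, Real.sin_pi_div_six]
    exact ha.2

lemma sin_mem_Ico {θ : ℝ} (hθ : θ ∈ Set.Ico (-(Real.pi / 3)) (Real.pi / 6)) :
    Real.sin θ ∈ Set.Ico (-(Real.sqrt 3) / 2) (1 / 2 : ℝ) := by
  have hpi := Real.pi_pos
  rw [← sin_neg_pi_div_three, ← Real.sin_pi_div_six]
  exact ⟨Real.sin_le_sin_of_le_of_le_pi_div_two (by linarith) (by linarith [hθ.2]) hθ.1,
    Real.sin_lt_sin_of_lt_of_le_pi_div_two (by linarith [hθ.1]) (by linarith) hθ.2⟩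

lemma sin_arcsin_of_mem_Ico {a : ℝ} (ha : a ∈ Set.Ico (-(Real.sqrt 3) / 2) (1 / 2 : ℝ)) :
    Real.sin (Real.arcsin a) = a := by
  have h3 : Real.sqrt 3 ≤ 2 := by
    rw [Real.sqrt_le_left (by norm_num)]
    norm_num
  exact Real.sin_arcsin (by linarith [ha.1]) (by linarith [ha.2])


theorem heisenberg_family2_t_range :
    StrictMonoOn
      (fun a : ℝ => -3 / (2 * (4 * a * ((-a + Real.sqrt (3 - 3*a^2)) / 2) + 5)))
      (Set.Ico (-(Real.sqrt 3) / 2) (1/2 : ℝ)) ∧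
    Set.BijOn
      (fun a : ℝ => -3 / (2 * (4 * a * ((-a + Real.sqrt (3 - 3*a^2)) / 2) + 5)))
      (Set.Ico (-(Real.sqrt 3) / 2) (1/2 : ℝ))
      (Set.Ico (-(3/4) : ℝ) (-(1/4) : ℝ)) := by
  have hpi := Real.pi_pos
  have hmono : StrictMonoOn
      (fun a : ℝ => -3 / (2 * (4 * a * ((-a + Real.sqrt (3 - 3*a^2)) / 2) + 5)))
      (Set.Ico (-(Real.sqrt 3) / 2) (1/2 : ℝ)) := by
    intro a ha b hb hab
    have hθ := arcsin_mem_Ico ha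
    have hη := arcsin_mem_Ico hb
    have ha' := sin_arcsin_of_mem_Ico ha
    have hb' := sin_arcsin_of_mem_Ico hb
    have hlt : Real.arcsin a < Real.arcsin b := by
      by_contra! h
      have := Real.monotone_arcsin hab.le
      rw [le_antisymm h this] at hb'
      linarith
    rw [← ha', ← hb']
    dsimp only
    rw [neg_three_div_eq_of_sin (Real.neg_pi_div_two_le_arcsin a) (Real.arcsin_le_pi_div_two a),
      neg_three_div_eq_of_sin (Real.neg_pi_div_two_le_arcsin b) (Real.arcsin_le_pi_div_two b)]
    have hsin := Real.sin_lt_sin_of_lt_of_le_pi_div_two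
      (x := 2 * Real.arcsin a + Real.pi / 6) (y := 2 * Real.arcsin b + Real.pi / 6)
      (by linarith [hθ.1]) (by linarith [hη.2]) (by linarith)
    have hl := Real.neg_one_le_sin (2 * Real.arcsin a + Real.pi / 6)
    rw [div_lt_div_iff₀ (by linarith) (by linarith)]
    linarith
  refine ⟨hmono, ?_, hmono.injOn, ?_⟩
  · intro a ha
    have hθ := arcsin_mem_Ico ha
    rw [← sin_arcsin_of_mem_Ico ha]
    dsimp only
    rw [neg_three_div_eq_of_sin (Real.neg_pi_div_two_le_arcsin a) (Real.arcsin_le_pi_div_two a)]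
    have hl := Real.neg_one_le_sin (2 * Real.arcsin a + Real.pi / 6)
    have hu := Real.sin_lt_sin_of_lt_of_le_pi_div_two
      (x := 2 * Real.arcsin a + Real.pi / 6) (y := Real.pi / 2)
      (by linarith [hθ.1]) le_rfl (by linarith [hθ.2])
    rw [Real.sin_pi_div_two] at hu
    constructor
    · rw [le_div_iff₀ (by linarith)]
      linarith
    · rw [div_lt_iff₀ (by linarith)]
      linarith
  · rintro y ⟨hy₁, hy₂⟩
    have hy : y < 0 := by linarith
    have hy₀ : y ≠ 0 := hy.ne
    have hl : -1 ≤ -3 / (4 * y) - 2 := by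
      have : 1 ≤ -3 / (4 * y) := by
        rw [le_div_iff_of_neg (by linarith)]
        linarith
      linarith
    have hu : -3 / (4 * y) - 2 < 1 := by
      have : -3 / (4 * y) < 3 := by
        rw [div_lt_iff_of_neg (by linarith)]
        linarith
      linarith
    have hα := Real.neg_pi_div_two_le_arcsin (-3 / (4 * y) - 2)
    have hβ := Real.arcsin_lt_pi_div_two.2 hu
    refine ⟨Real.sin ((Real.arcsin (-3 / (4 * y) - 2) - Real.pi / 6) / 2),
      sin_mem_Ico ⟨by linarith, by linarith⟩, ?_⟩
    dsimp only
    rw [neg_three_div_eq_of_sin (by linarith) (by linarith), mul_div_cancel₀ _ two_ne_zero,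
      sub_add_cancel, Real.sin_arcsin hl hu.le]
    field_simp
    ring_nf
end

section
/- For every c ∈ (0, 1/2) ∪ (√(7/8), ∞) there exists a unique pair (a,d) of real numbers with a < 0 < d and |a| < d satisfying both 3a² + 4c² + 3d² + 10ad = 0 and 32c⁴ + (32ad + 8)c² − 28ad − 9 = 0. -/
/-- A pair of reals with negative product and positive sum exists and is unique, given the product
and the square of the sum, once it is ordered by sign. -/
lemma existsUnique_pair_of_mul_eq_of_sq_add_eq {p q : ℝ} (hp : p < 0) (hq : 0 < q) :
    ∃! x : ℝ × ℝ, x.1 < 0 ∧ 0 < x.2 ∧ |x.1| < x.2 ∧ x.1 * x.2 = p ∧ (x.1 + x.2) ^ 2 = q := by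
  have hs : 0 < √q := Real.sqrt_pos.2 hq
  have hs2 : √q ^ 2 = q := Real.sq_sqrt hq.le
  have hr2 : √(q - 4 * p) ^ 2 = q - 4 * p := Real.sq_sqrt (by linarith)
  have hsr : √q < √(q - 4 * p) := Real.sqrt_lt_sqrt hq.le (by linarith)
  refine ⟨((√q - √(q - 4 * p)) / 2, (√q + √(q - 4 * p)) / 2), ⟨?_, ?_, ?_, ?_, ?_⟩, ?_⟩
  · dsimp only; linarith
  · dsimp only; linarith
  · dsimp only
    rw [abs_lt]
    constructor <;> linarith
  · dsimp only; linarith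
  · dsimp only; linear_combination hs2
  · rintro ⟨a, d⟩ ⟨ha, hd, had, hmul, hadd⟩
    dsimp only at ha hd had hmul hadd
    have hsum : √q = a + d := by
      rw [← hadd, Real.sqrt_sq (by linarith [(abs_lt.1 had).1])]
    have hdiff : √(q - 4 * p) = d - a := by
      rw [← hadd, ← hmul, show (a + d) ^ 2 - 4 * (a * d) = (d - a) ^ 2 by ring,
        Real.sqrt_sq (by linarith)]
    rw [hsum, hdiff]
    ext <;> dsimp only <;> ring

theorem heisenberg_family5_unique_pair (c : ℝ)
    (hc : c ∈ Set.Ioo (0:ℝ) (1/2) ∪ Set.Ioi (Real.sqrt (7/8))) :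
    ∃! x : ℝ × ℝ,
      x.1 < 0 ∧ 0 < x.2 ∧ |x.1| < x.2 ∧
      3*x.1^2 + 4*c^2 + 3*x.2^2 + 10*x.1*x.2 = 0 ∧
      32*c^4 + (32*x.1*x.2 + 8)*c^2 - 28*x.1*x.2 - 9 = 0 := by
  have hquot : 8 * c ^ 2 - 7 ≠ 0 ∧ 0 < (4 * c ^ 2 - 1) / (8 * c ^ 2 - 7) := by
    rcases hc with ⟨h0, h1⟩ | h
    · have h2 : c ^ 2 < 1 / 4 := by nlinarith
      exact ⟨by linarith, div_pos_of_neg_of_neg (by linarith) (by linarith)⟩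
    · have h2 : 7 / 8 < c ^ 2 := Real.lt_sq_of_sqrt_lt h
      exact ⟨by linarith, div_pos (by linarith) (by linarith)⟩
  obtain ⟨hne, hpos⟩ := hquot
  set k := (4 * c ^ 2 - 1) / (8 * c ^ 2 - 7) with hk
  have hk' : k * (8 * c ^ 2 - 7) = 4 * c ^ 2 - 1 := div_mul_cancel₀ _ hne
  have hp : -c ^ 2 - 9 / 4 * k < 0 := by nlinarith [sq_nonneg c]
  have hq : 0 < 3 * k := by linarith
  refine (existsUnique_congr fun x => ?_).1 (existsUnique_pair_of_mul_eq_of_sq_add_eq hp hq)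
  refine and_congr_right fun _ => and_congr_right fun _ => and_congr_right fun _ => ⟨?_, ?_⟩
  · rintro ⟨hmul, hadd⟩
    constructor
    · linear_combination 3 * hadd + 4 * hmul
    · linear_combination (32 * c ^ 2 - 28) * hmul - 9 * hk'
  · rintro ⟨h1, h2⟩
    have hmul : x.1 * x.2 = -c ^ 2 - 9 / 4 * k := by
      apply mul_right_cancel₀ hne
      linear_combination h2 / 4 + 9 / 4 * hk'
    exact ⟨hmul, by linear_combination h1 / 3 - 4 / 3 * hmul⟩
end

section
/- For every H ∈ (0, √(3/7)), the equation 4d⁶ + 5(3H²−1)d⁴ + (18H⁴+6H²+13)d² + (H²+1)²(7H²−3) = 0 has exactly one solution with d > 0, and this solution satisfies 2d² + 2H² < 3; equivalently, a = −(2d²+2H²−3)d/(2(d²+H²+1)) is positive. -/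
/-- The sextic determining `d`, as a cubic in `x = d ^ 2` and `h = H ^ 2`, is strictly increasing
in `x` for `0 ≤ h ≤ 1`. -/
lemma family6_cubic_strictMono {h : ℝ} (h0 : 0 ≤ h) (h1 : h ≤ 1) :
    StrictMono fun x : ℝ =>
      4*x^3 + 5*(3*h - 1)*x^2 + (18*h^2 + 6*h + 13)*x + (h + 1)^2 * (7*h - 3) := by
  intro x y hxy
  have hq : 0 < 4*(x^2 + x*y + y^2) + 5*(3*h - 1)*(x + y) + (18*h^2 + 6*h + 13) := by
    nlinarith [sq_nonneg (x - y), sq_nonneg (6*(x + y) + 5*(3*h - 1)), mul_nonneg h0 (sub_nonneg.2 h1)]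
  have := mul_pos (sub_pos.2 hxy) hq
  simp only
  linarith

theorem heisenberg_family6_unique_d (H : ℝ)
    (hH : H ∈ Set.Ioo (0:ℝ) (Real.sqrt (3/7))) :
    (∃! d : ℝ, 0 < d ∧
      4*d^6 + 5*(3*H^2 - 1)*d^4 + (18*H^4 + 6*H^2 + 13)*d^2
        + (H^2 + 1)^2 * (7*H^2 - 3) = 0) ∧
    (∀ d : ℝ, 0 < d →
      4*d^6 + 5*(3*H^2 - 1)*d^4 + (18*H^4 + 6*H^2 + 13)*d^2
        + (H^2 + 1)^2 * (7*H^2 - 3) = 0 →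
      2*d^2 + 2*H^2 < 3 ∧ 0 < -(2*d^2 + 2*H^2 - 3) * d / (2*(d^2 + H^2 + 1))) := by
  have hlt : H^2 < 3/7 := (Real.lt_sqrt hH.1.le).1 hH.2
  have hpos : 0 < H^2 := pow_pos hH.1 2
  have hmono := family6_cubic_strictMono hpos.le (by linarith)
  have hone : 0 < 4 + 5*(3*H^2 - 1) + (18*H^4 + 6*H^2 + 13) + (H^2 + 1)^2 * (7*H^2 - 3) := by
    have : 0 < 9 + 22*H^2 + 29*H^4 + 7*H^6 := by positivity
    linarith
  refine ⟨?_, fun d hd heq => ?_⟩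
  · obtain ⟨d, hd, heq⟩ := intermediate_value_Ioo (zero_le_one (α := ℝ))
      (f := fun d => 4*d^6 + 5*(3*H^2 - 1)*d^4 + (18*H^4 + 6*H^2 + 13)*d^2
        + (H^2 + 1)^2 * (7*H^2 - 3)) (by fun_prop)
      (show (0:ℝ) ∈ Set.Ioo _ _ from
        ⟨by
          have := mul_pos (show 0 < (H^2 + 1)^2 by positivity) (show 0 < 3 - 7*H^2 by linarith)
          linarith, by
          linarith⟩)
    refine ⟨d, ⟨hd.1, heq⟩, fun e ⟨he, heq'⟩ => ?_⟩
    have hsq : e^2 = d^2 := hmono.injective (by simp only at heq; linarith)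
    exact (pow_left_inj₀ he.le hd.1.le two_ne_zero).1 hsq
  · have hd1 : d^2 < 1 := hmono.lt_iff_lt.1 (by linarith)
    refine ⟨by linarith, div_pos (mul_pos (by linarith) hd) (by positivity)⟩
end

section
/- Let ζ be the unique real root of 8p³ + 15p² + 3p + 1 (so ζ ∈ (−2,−1)). For every p ∈ (ζ, −1) ∪ ((1−√21)/10, 0), one has (p+2)(5p²−p−1) ≠ 0 and both quantities −(2p+1)(8p³+15p²+3p+1)/((p+2)(5p²−p−1)) and (p−1)(p+1)(5p³+12p²+1)/((p+2)(5p²−p−1)) are strictly positive. -/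
theorem r3_family5_positivity (ζ : ℝ)
    (hζ : 8*ζ^3 + 15*ζ^2 + 3*ζ + 1 = 0)
    (hζu : ∀ w : ℝ, 8*w^3 + 15*w^2 + 3*w + 1 = 0 → w = ζ)
    (hζmem : ζ ∈ Set.Ioo (-2 : ℝ) (-1 : ℝ))
    (p : ℝ)
    (hp : p ∈ Set.Ioo ζ (-1 : ℝ) ∪ Set.Ioo ((1 - Real.sqrt 21)/10) (0 : ℝ)) :
    (p + 2) * (5*p^2 - p - 1) ≠ 0 ∧
    0 < -(2*p + 1) * (8*p^3 + 15*p^2 + 3*p + 1) / ((p + 2) * (5*p^2 - p - 1)) ∧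
    0 < (p - 1) * (p + 1) * (5*p^3 + 12*p^2 + 1) / ((p + 2) * (5*p^2 - p - 1)) := by
  obtain ⟨hζ2, hζ1⟩ := hζmem
  rcases hp with ⟨h1, h2⟩ | ⟨h1, h2⟩
  · have hp2 : 0 < p + 2 := by linarith
    have hq : 0 < 5*p^2 - p - 1 := by nlinarith
    have hden := mul_pos hp2 hq
    have hf : 0 < 8*p^3 + 15*p^2 + 3*p + 1 := by
      -- the cubic is concave on `(-∞, -1]`, hence above its chord over `[ζ, -1]`
      have hchord : 0 < (-1 - ζ) * (8*p^3 + 15*p^2 + 3*p + 1) := by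
        have hpos : 0 < (-1 - ζ) * (p - ζ) * (-1 - p) * (-(8*(p + ζ) + 7)) :=
          mul_pos (mul_pos (mul_pos (by linarith) (by linarith)) (by linarith)) (by linarith)
        linear_combination 5 * h1 + hpos + (1 + p) * hζ
      exact pos_of_mul_pos_right hchord (by linarith)
    refine ⟨hden.ne', div_pos (mul_pos (by linarith) hf) hden, div_pos (mul_pos ?_ ?_) hden⟩
    · exact mul_pos_of_neg_of_neg (by linarith) (by linarith)
    · nlinarith [mul_nonneg (sq_nonneg p) (by linarith : (0 : ℝ) ≤ 5*p + 12)]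
  · have hs : Real.sqrt 21 ^ 2 = 21 := Real.sq_sqrt (by norm_num)
    have hs0 : 0 ≤ Real.sqrt 21 := Real.sqrt_nonneg 21
    have hs5 : Real.sqrt 21 < 5 := by nlinarith
    have hlow : -(2/5) < p := by linarith
    have hq : 5*p^2 - p - 1 < 0 := by nlinarith
    have hden := mul_neg_of_pos_of_neg (by linarith : 0 < p + 2) hq
    have hf : 0 < 8*p^3 + 15*p^2 + 3*p + 1 := by
      nlinarith [mul_nonneg (sq_nonneg p) (by linarith : (0 : ℝ) ≤ 8*p + 16/5),
        sq_nonneg (p + 1/8)]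
    refine ⟨hden.ne, div_pos_of_neg_of_neg (mul_neg_of_neg_of_pos (by linarith) hf) hden,
      div_pos_of_neg_of_neg (mul_neg_of_neg_of_pos ?_ ?_) hden⟩
    · exact mul_neg_of_neg_of_pos (by linarith) (by linarith)
    · nlinarith [mul_nonneg (sq_nonneg p) (by linarith : (0 : ℝ) ≤ 5*p + 12)]
end

section
/- For every b > 0, the equation 9a² − 18b² − 6a − 8 = 0 has a unique solution with a > 0, namely a = (1 + 3√(1+2b²))/3, and this solution satisfies a > 4/3. Moreover, the function b ↦ −(18b²+7)/(12b²+10) is a strictly decreasing bijection from (0,∞) onto (−3/2, −7/10). -/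
theorem strictAntiOn_family7_t :
    StrictAntiOn (fun b : ℝ => -(18*b^2 + 7) / (12*b^2 + 10)) (Set.Ioi (0:ℝ)) := by
  intro x hx y _ hxy
  have hx0 : 0 < x := hx
  have hsq : x^2 < y^2 := by gcongr
  have h₁ : 0 < 12*x^2 + 10 := by positivity
  have h₂ : 0 < 12*y^2 + 10 := by positivity
  change -(18*y^2 + 7) / (12*y^2 + 10) < -(18*x^2 + 7) / (12*x^2 + 10)
  rw [div_lt_div_iff₀ h₂ h₁]
  linarith

theorem r3_family7_a_and_t_range :
    (∀ b : ℝ, 0 < b →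
      (∀ a : ℝ, (0 < a ∧ 9*a^2 - 18*b^2 - 6*a - 8 = 0) ↔
        a = (1 + 3 * Real.sqrt (1 + 2*b^2)) / 3) ∧
      4/3 < (1 + 3 * Real.sqrt (1 + 2*b^2)) / 3) ∧
    StrictAntiOn (fun b : ℝ => -(18*b^2 + 7) / (12*b^2 + 10)) (Set.Ioi (0:ℝ)) ∧
    Set.BijOn (fun b : ℝ => -(18*b^2 + 7) / (12*b^2 + 10))
      (Set.Ioi (0:ℝ)) (Set.Ioo (-(3/2) : ℝ) (-(7/10) : ℝ)) := by
  refine ⟨fun b hb => ?_, strictAntiOn_family7_t, ?_, strictAntiOn_family7_t.injOn, ?_⟩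
  · have hb2 : 0 < b^2 := by positivity
    have hs : Real.sqrt (1 + 2*b^2) ^ 2 = 1 + 2*b^2 := Real.sq_sqrt (by positivity)
    have hs1 : 1 < Real.sqrt (1 + 2*b^2) := Real.lt_sqrt_of_sq_lt (by linarith)
    set s := Real.sqrt (1 + 2*b^2)
    refine ⟨fun a => ⟨fun ⟨ha, h⟩ => ?_, ?_⟩, by linarith⟩
    · have hprod : (3*a - 1 - 3*s) * (3*a - 1 + 3*s) = 0 := by linear_combination h - 9 * hs
      have hne : 3*a - 1 + 3*s ≠ 0 := by linarith
      have := (mul_eq_zero.mp hprod).resolve_right hne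
      linarith
    · rintro rfl
      exact ⟨by linarith, by linear_combination 9 * hs⟩
  · intro b hb
    have hb0 : 0 < b := hb
    have hb2 : 0 < b^2 := by positivity
    have hd : 0 < 12*b^2 + 10 := by positivity
    refine ⟨?_, ?_⟩
    · change -(3/2) < -(18*b^2 + 7) / (12*b^2 + 10)
      rw [lt_div_iff₀ hd]
      linarith
    · change -(18*b^2 + 7) / (12*b^2 + 10) < -(7/10)
      rw [div_lt_iff₀ hd]
      linarith
  · rintro t ⟨ht₁, ht₂⟩
    have hd : 0 < 12*t + 18 := by linarith
    have hx : 0 < -(7 + 10*t) / (12*t + 18) := div_pos (by linarith) hd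
    refine ⟨Real.sqrt (-(7 + 10*t) / (12*t + 18)), Real.sqrt_pos.mpr hx, ?_⟩
    change -(18*Real.sqrt _ ^ 2 + 7) / (12*Real.sqrt _ ^ 2 + 10) = t
    rw [Real.sq_sqrt hx.le, div_eq_iff (by positivity)]
    linear_combination -div_mul_cancel₀ (-(7 + 10*t)) hd.ne'
end
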